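/- For a correct model versioning Δ over models M_1, …, M_n with multi-version model MVM = comb(Δ), for all versions M_i, M_j it holds that proj^Δ(comb(Δ), i, j) = m_{i,j}, where m_{i,j} is the (unique) maximally preserving model modification from M_i to M_j. -/

import Mathlib

/-! ## Common framework

Graph elements are drawn from global universes `N` (nodes) and `E` (edges)
with globally fixed incidence functions `src`, `tgt` (element identity across
graphs; sources and targets are invariant).  A graph is a pair of subsets. -/

/-- A graph given by its sets of node- and edge-identifiers. -/
structure PreGraph (N : Type) (E : Type) where
  verts : Set N
  edges : Set E

/-- `G` is a proper graph w.r.t. the global incidence functions. -/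
def IsGraph {N E : Type} (src tgt : E → N) (G : PreGraph N E) : Prop :=
  (∀ e ∈ G.edges, src e ∈ G.verts) ∧ (∀ e ∈ G.edges, tgt e ∈ G.verts)

/-- Membership of an element (node or edge) in a graph. -/
def memEl {N E : Type} (x : N ⊕ E) (G : PreGraph N E) : Prop :=
  Sum.elim (· ∈ G.verts) (· ∈ G.edges) x

/-- A model modification `(base ← mid → res)`; the two morphisms are partial
identities, i.e. set inclusions (see `Modif.Proper`). -/
structure Modif (N : Type) (E : Type) where
  base : PreGraph N E
  mid : PreGraph N E
  res : PreGraph N E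

/-- The span consists of proper graphs and the morphisms are inclusions. -/
def Modif.Proper {N E : Type} (src tgt : E → N) (m : Modif N E) : Prop :=
  IsGraph src tgt m.base ∧ IsGraph src tgt m.mid ∧ IsGraph src tgt m.res ∧
  m.mid.verts ⊆ m.base.verts ∧ m.mid.edges ⊆ m.base.edges ∧
  m.mid.verts ⊆ m.res.verts ∧ m.mid.edges ⊆ m.res.edges

/-- A modification is maximally preserving iff `K = G ∩ H`. -/
def Modif.MaxPreserving {N E : Type} (m : Modif N E) : Prop :=
  m.mid.verts = m.base.verts ∩ m.res.verts ∧ m.mid.edges = m.base.edges ∩ m.res.edges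

def Modif.deletedV {N E : Type} (m : Modif N E) : Set N := m.base.verts \ m.mid.verts
def Modif.createdV {N E : Type} (m : Modif N E) : Set N := m.res.verts \ m.mid.verts
def Modif.deletedE {N E : Type} (m : Modif N E) : Set E := m.base.edges \ m.mid.edges
def Modif.createdE {N E : Type} (m : Modif N E) : Set E := m.res.edges \ m.mid.edges

/-- `mcheck m1 m2`: all insert-delete conflicts `(e, v)` between two
modifications with common source: one modification creates the edge `e`
whose source or target node `v` is deleted by the other modification. -/
def mcheck {N E : Type} (src tgt : E → N) (m1 m2 : Modif N E) : Set (E × N) :=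
  {p | (src p.1 = p.2 ∨ tgt p.1 = p.2) ∧
    ((p.1 ∈ m1.createdE ∧ p.2 ∈ m2.deletedV) ∨
     (p.1 ∈ m2.createdE ∧ p.2 ∈ m1.deletedV))}

/-- Three-way merge equipped with a conflict resolution strategy `str`:
for each insert-delete conflict, `str = true` means the node deletion is
reverted, `str = false` means the edge creation is reverted.  The merged graph
contains the elements preserved by both modifications and the elements created
by either modification, as altered by the strategy's resolutions. -/
def mergeGr {N E : Type} (src tgt : E → N) (m1 m2 : Modif N E)
    (str : E × N → Bool) : PreGraph N E where
  verts := (m1.mid.verts ∩ m2.mid.verts) ∪ m1.createdV ∪ m2.createdV ∪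
    {v | ∃ e, (e, v) ∈ mcheck src tgt m1 m2 ∧ str (e, v) = true}
  edges := (m1.mid.edges ∩ m2.mid.edges) ∪
    {e | e ∈ m1.createdE ∪ m2.createdE ∧
      ∀ v, (e, v) ∈ mcheck src tgt m1 m2 → str (e, v) = true}

/-- A strategy is valid iff it always produces a proper merged graph. -/
def ValidStrategy {N E : Type} (src tgt : E → N) (m1 m2 : Modif N E)
    (str : E × N → Bool) : Prop :=
  IsGraph src tgt (mergeGr src tgt m1 m2 str)

/-- The deletion-favouring merge `merge_G^min`: preserved elements together
with created elements, excluding every created edge whose source or target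
node is deleted by the other modification. -/
def mergeMin {N E : Type} (src tgt : E → N) (m1 m2 : Modif N E) : PreGraph N E :=
  mergeGr src tgt m1 m2 (fun _ => false)

/-! ## Patterns and matches -/

/-- A violation pattern: a graph typed over the type graph `(TN, TE)`. -/
structure Pattern (TN : Type) (TE : Type) where
  NQ : Type
  EQ : Type
  srcQ : EQ → NQ
  tgtQ : EQ → NQ
  tyV : NQ → TN
  tyE : EQ → TE

/-- A match: a typed graph monomorphism from the pattern `Q` into `X`
(elements of `X` are typed by the global typing `tyN`, `tyEg`). -/
structure IsMatch {N E TN TE : Type} (src tgt : E → N) (tyN : N → TN)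
    (tyEg : E → TE) (Q : Pattern TN TE) (X : PreGraph N E)
    (fv : Q.NQ → N) (fe : Q.EQ → E) : Prop where
  inj_v : Function.Injective fv
  inj_e : Function.Injective fe
  comm_src : ∀ e, src (fe e) = fv (Q.srcQ e)
  comm_tgt : ∀ e, tgt (fe e) = fv (Q.tgtQ e)
  ty_v : ∀ v, tyN (fv v) = Q.tyV v
  ty_e : ∀ e, tyEg (fe e) = Q.tyE e
  mem_v : ∀ v, fv v ∈ X.verts
  mem_e : ∀ e, fe e ∈ X.edges

/-- `pcheck X φ`: the set of all matches of the violation pattern into `X`. -/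
def pcheck {N E TN TE : Type} (src tgt : E → N) (tyN : N → TN) (tyEg : E → TE)
    (Q : Pattern TN TE) (X : PreGraph N E) : Set ((Q.NQ → N) × (Q.EQ → E)) :=
  {m | IsMatch src tgt tyN tyEg Q X m.1 m.2}

/-! ## Correct model versionings -/

/-- A correct model versioning: models `M i`, modification relation `delta`
(each modification is the maximally preserving one, with partial-identity
morphisms, between its endpoints — it is determined by the two endpoints),
an acyclic predecessor relation, and an initial model `root`. -/
structure Versioning (N : Type) (E : Type) (src tgt : E → N) (ι : Type) where
  M : ι → PreGraph N E
  isGraph : ∀ i, IsGraph src tgt (M i)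
  delta : ι → ι → Prop
  acyclic : ∀ i, ¬ Relation.TransGen delta i i
  root : ι
  root_pre : ∀ i, i ≠ root → Relation.TransGen delta root i

namespace Versioning

variable {N E ι : Type} {src tgt : E → N}

/-- `pre a b`: `a` is a predecessor of `b`. -/
def pre (V : Versioning N E src tgt ι) (a b : ι) : Prop :=
  Relation.TransGen V.delta a b

/-- The union `P^M` of all model versions. -/
def unionPG (V : Versioning N E src tgt ι) : PreGraph N E :=
  ⟨⋃ i, (V.M i).verts, ⋃ i, (V.M i).edges⟩

/-- `cv` edges of the multi-version model: element `x` has a `cv` edge to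
version `j` iff some modification into `M j` creates `x`, or `j` is the
initial version and `x ∈ M root`. -/
def cvR (V : Versioning N E src tgt ι) (x : N ⊕ E) (j : ι) : Prop :=
  (∃ i, V.delta i j ∧ ¬ memEl x (V.M i) ∧ memEl x (V.M j)) ∨
  (j = V.root ∧ memEl x (V.M V.root))

/-- `dv` edges: element `x` has a `dv` edge to version `j` iff some
modification into `M j` deletes `x`. -/
def dvR (V : Versioning N E src tgt ι) (x : N ⊕ E) (j : ι) : Prop :=
  ∃ i, V.delta i j ∧ memEl x (V.M i) ∧ ¬ memEl x (V.M j)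

/-- mv-presence: `x` is mv-present in version `i` iff there is a version `j`
with a `cv` edge from `x` and a path of `suc` edges from `j` to `i` that does
not pass through any version with a `dv` edge from `x`. -/
def mvPresent (V : Versioning N E src tgt ι) (x : N ⊕ E) (i : ι) : Prop :=
  ∃ j, V.cvR x j ∧ ¬ V.dvR x j ∧
    Relation.ReflTransGen (fun a b => V.delta a b ∧ ¬ V.dvR x b) j i

/-- `p x`: the set of versions in which `x` is mv-present. -/
def pSet (V : Versioning N E src tgt ι) (x : N ⊕ E) : Set ι :=
  {i | V.mvPresent x i}

/-- The projection `proj(MVM, i)`. -/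
def projPG (V : Versioning N E src tgt ι) (i : ι) : PreGraph N E :=
  ⟨{v | V.mvPresent (Sum.inl v) i}, {e | V.mvPresent (Sum.inr e) i}⟩

/-- `proj^Δ(MVM, c, i)`: the maximally preserving model modification from
`proj(MVM, c)` to `proj(MVM, i)`. -/
def projModif (V : Versioning N E src tgt ι) (c i : ι) : Modif N E :=
  ⟨V.projPG c,
   ⟨(V.projPG c).verts ∩ (V.projPG i).verts,
    (V.projPG c).edges ∩ (V.projPG i).edges⟩,
   V.projPG i⟩

/-- `pre^C i j`: the set of latest common predecessors (empty if one of the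
two versions is a predecessor of the other). -/
def preC (V : Versioning N E src tgt ι) (i j : ι) : Set ι :=
  {c | ¬ V.pre i j ∧ ¬ V.pre j i ∧ V.pre c i ∧ V.pre c j ∧
       ∀ x, V.pre x i → V.pre x j → ¬ V.pre c x}

end Versioning

/-! ## The multi-version model as a typed graph -/

/-- A typed graph (over the node-type universe `TN` and edge-type universe
`TE` of its type graph). -/
structure TypedGraph (TN : Type) (TE : Type) where
  V : Type
  Ed : Type
  Vset : Set V
  Eset : Set Ed
  s : Ed → V
  t : Ed → V
  tyV : V → TN
  tyE : Ed → TE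

/-- Node types of the adapted type graph `TM_mv`: a node `corr_mv x` for each
node and each edge `x` of `TM`, plus the node `version`. -/
abbrev TNmv (TN TE : Type) : Type := (TN ⊕ TE) ⊕ Unit

/-- Edge types of `TM_mv`: `corr^s`, `corr^t`, `suc`, `cv`, `dv`. -/
abbrev TEmv (TN TE : Type) : Type :=
  (TE ⊕ TE) ⊕ (Unit ⊕ ((TN ⊕ TE) ⊕ (TN ⊕ TE)))

/-- Nodes of the multi-version model: one node per element of `P^M`
(the `origin` bijection is the identity on `N ⊕ E`) and one node per version. -/
abbrev MVNode (N E ι : Type) : Type := (N ⊕ E) ⊕ ι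

/-- Edges of the multi-version model: source- and target-encoding edges,
`suc` edges, `cv` edges and `dv` edges. -/
abbrev MVEdge (N E ι : Type) : Type :=
  (E ⊕ E) ⊕ ((ι × ι) ⊕ (((N ⊕ E) × ι) ⊕ ((N ⊕ E) × ι)))

/-- A typed graph monomorphism. -/
def IsTypedMono {TN TE : Type} (A B : TypedGraph TN TE)
    (fv : A.V → B.V) (fe : A.Ed → B.Ed) : Prop :=
  Function.Injective fv ∧ Function.Injective fe ∧
  (∀ v ∈ A.Vset, fv v ∈ B.Vset) ∧ (∀ e ∈ A.Eset, fe e ∈ B.Eset) ∧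
  (∀ e, B.s (fe e) = fv (A.s e)) ∧ (∀ e, B.t (fe e) = fv (A.t e)) ∧
  (∀ v, B.tyV (fv v) = A.tyV v) ∧ (∀ e, B.tyE (fe e) = A.tyE e)

/-- `trans_mv Q`: the translation of a pattern `Q` (typed over `TM`) to a
typed graph over `TM_mv`; `origin_Q` is the identity. -/
def Pattern.transMV {TN TE : Type} (Q : Pattern TN TE) :
    TypedGraph (TNmv TN TE) (TEmv TN TE) where
  V := Q.NQ ⊕ Q.EQ
  Ed := Q.EQ ⊕ Q.EQ
  Vset := Set.univ
  Eset := Set.univ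
  s := Sum.elim (fun e => Sum.inr e) (fun e => Sum.inr e)
  t := Sum.elim (fun e => Sum.inl (Q.srcQ e)) (fun e => Sum.inl (Q.tgtQ e))
  tyV := Sum.elim (fun v => Sum.inl (Sum.inl (Q.tyV v)))
    (fun e => Sum.inl (Sum.inr (Q.tyE e)))
  tyE := Sum.elim (fun e => Sum.inl (Sum.inl (Q.tyE e)))
    (fun e => Sum.inl (Sum.inr (Q.tyE e)))

/-- `comb Δ`: the multi-version model of a correct model versioning, as a
typed graph over the adapted type graph (global element typing `tyN`, `tyEg`). -/
def Versioning.comb {N E ι TN TE : Type} {src tgt : E → N}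
    (V : Versioning N E src tgt ι) (tyN : N → TN) (tyEg : E → TE) :
    TypedGraph (TNmv TN TE) (TEmv TN TE) where
  V := MVNode N E ι
  Ed := MVEdge N E ι
  Vset := {w | match w with
    | Sum.inl (Sum.inl v) => v ∈ V.unionPG.verts
    | Sum.inl (Sum.inr e) => e ∈ V.unionPG.edges
    | Sum.inr _ => True}
  Eset := {w | match w with
    | Sum.inl (Sum.inl e) => e ∈ V.unionPG.edges
    | Sum.inl (Sum.inr e) => e ∈ V.unionPG.edges
    | Sum.inr (Sum.inl (i, j)) => V.delta i j
    | Sum.inr (Sum.inr (Sum.inl (x, j))) => V.cvR x j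
    | Sum.inr (Sum.inr (Sum.inr (x, j))) => V.dvR x j}
  s := fun w => match w with
    | Sum.inl (Sum.inl e) => Sum.inl (Sum.inr e)
    | Sum.inl (Sum.inr e) => Sum.inl (Sum.inr e)
    | Sum.inr (Sum.inl (i, _)) => Sum.inr i
    | Sum.inr (Sum.inr (Sum.inl (x, _))) => Sum.inl x
    | Sum.inr (Sum.inr (Sum.inr (x, _))) => Sum.inl x
  t := fun w => match w with
    | Sum.inl (Sum.inl e) => Sum.inl (Sum.inl (src e))
    | Sum.inl (Sum.inr e) => Sum.inl (Sum.inl (tgt e))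
    | Sum.inr (Sum.inl (_, j)) => Sum.inr j
    | Sum.inr (Sum.inr (Sum.inl (_, j))) => Sum.inr j
    | Sum.inr (Sum.inr (Sum.inr (_, j))) => Sum.inr j
  tyV := fun w => match w with
    | Sum.inl (Sum.inl v) => Sum.inl (Sum.inl (tyN v))
    | Sum.inl (Sum.inr e) => Sum.inl (Sum.inr (tyEg e))
    | Sum.inr _ => Sum.inr ()
  tyE := fun w => match w with
    | Sum.inl (Sum.inl e) => Sum.inl (Sum.inl (tyEg e))
    | Sum.inl (Sum.inr e) => Sum.inl (Sum.inr (tyEg e))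
    | Sum.inr (Sum.inl _) => Sum.inr (Sum.inl ())
    | Sum.inr (Sum.inr (Sum.inl (x, _))) =>
        Sum.inr (Sum.inr (Sum.inl (Sum.elim (fun v => Sum.inl (tyN v))
          (fun e => Sum.inr (tyEg e)) x)))
    | Sum.inr (Sum.inr (Sum.inr (x, _))) =>
        Sum.inr (Sum.inr (Sum.inr (Sum.elim (fun v => Sum.inl (tyN v))
          (fun e => Sum.inr (tyEg e)) x)))

/-- `Corr Q fv m` states `m = origin ∘ m_mv ∘ origin_Q⁻¹` for the node
function `fv` of a morphism `m_mv : trans_mv Q → MVM`. -/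
def Corr {N E TN TE ι : Type} (Q : Pattern TN TE)
    (fv : (Q.NQ ⊕ Q.EQ) → MVNode N E ι)
    (m : (Q.NQ → N) × (Q.EQ → E)) : Prop :=
  (∀ v, fv (Sum.inl v) = Sum.inl (Sum.inl (m.1 v))) ∧
  (∀ e, fv (Sum.inr e) = Sum.inl (Sum.inr (m.2 e)))

/-- mv-presence set of a node of the multi-version model (element-representing
nodes only; version nodes get `∅`). -/
def Versioning.pOf {N E ι : Type} {src tgt : E → N}
    (V : Versioning N E src tgt ι) (w : MVNode N E ι) : Set ι :=
  match w with
  | Sum.inl x => V.pSet x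
  | Sum.inr _ => ∅

/-- `pcheck_mv(MVM, φ)`: all matches `m_mv` of `trans_mv Q` into `MVM` are
found; for each, `P = ⋂_{v} p (m_mv v)` is computed and, if `P ≠ ∅`, the
corresponding match `m = origin ∘ m_mv ∘ origin_Q⁻¹` is reported as a
violation in every version of `P`. -/
def pcheckMV {N E TN TE ι : Type} (src tgt : E → N) (tyN : N → TN)
    (tyEg : E → TE) (V : Versioning N E src tgt ι) (Q : Pattern TN TE) :
    Set (ι × ((Q.NQ → N) × (Q.EQ → E))) :=
  {p | ∃ (fv : (Q.NQ ⊕ Q.EQ) → MVNode N E ι) (fe : (Q.EQ ⊕ Q.EQ) → MVEdge N E ι),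
    IsTypedMono Q.transMV (V.comb tyN tyEg) fv fe ∧
    Corr Q fv p.2 ∧
    ∀ v : Q.NQ ⊕ Q.EQ, p.1 ∈ V.pOf (fv v)}

/-- `mcheck_mv(MVM)`: all insert-delete conflicts of all possible merges,
computed on the multi-version model and reported in normalized form. -/
def mcheckMV {N E ι : Type} [LinearOrder ι] (src tgt : E → N)
    (V : Versioning N E src tgt ι) : Set (ι × ι × ι × (E × N)) :=
  {q | ∃ e v i j c, q = (min i j, max i j, c, (e, v)) ∧
    (v = src e ∨ v = tgt e) ∧
    (∃ j', V.cvR (Sum.inr e) j' ∧ j' ≠ V.root) ∧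
    V.pSet (Sum.inr e) ≠ V.pSet (Sum.inl v) ∧
    i ∈ V.pSet (Sum.inr e) ∧
    (∃ k, V.dvR (Sum.inl v) k ∧ ¬ V.cvR (Sum.inl v) k ∧
      Relation.ReflTransGen (fun a b => V.delta a b ∧ ¬ V.cvR (Sum.inl v) b) k j) ∧
    c ∈ V.preC i j ∧ c ∈ V.pSet (Sum.inl v) ∧ c ∉ V.pSet (Sum.inr e)}

/-- `pcheck^m_mv(MVM, φ)`: for each match `m_mv` of `trans_mv Q` into `MVM`
with corresponding match `m`, each pair of versions `i`, `j` such that every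
node in the image of `m_mv` is mv-present in `i` or in `j`, and each latest
common predecessor `c ∈ pre^C(i, j)` such that every element matched by `m`
that lies in `M c` lies in both `M i` and `M j`, the normalized tuple
`(min i j, max i j, c, m)` is reported. -/
def pcheckMergeMV {N E TN TE ι : Type} [LinearOrder ι] (src tgt : E → N)
    (tyN : N → TN) (tyEg : E → TE) (V : Versioning N E src tgt ι)
    (Q : Pattern TN TE) :
    Set (ι × ι × ι × ((Q.NQ → N) × (Q.EQ → E))) :=
  {q | ∃ i j c m, q = (min i j, max i j, c, m) ∧
    ∃ (fv : (Q.NQ ⊕ Q.EQ) → MVNode N E ι) (fe : (Q.EQ ⊕ Q.EQ) → MVEdge N E ι),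
      IsTypedMono Q.transMV (V.comb tyN tyEg) fv fe ∧
      Corr Q fv m ∧
      (∀ v : Q.NQ ⊕ Q.EQ, i ∈ V.pOf (fv v) ∨ j ∈ V.pOf (fv v)) ∧
      c ∈ V.preC i j ∧
      (∀ v : Q.NQ, m.1 v ∈ (V.M c).verts →
        m.1 v ∈ (V.M i).verts ∧ m.1 v ∈ (V.M j).verts) ∧
      (∀ e : Q.EQ, m.2 e ∈ (V.M c).edges →
        m.2 e ∈ (V.M i).edges ∧ m.2 e ∈ (V.M j).edges)}

namespace Versioning

theorem not_dvR_of_memEl {N E ι : Type} {src tgt : E → N}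
    (V : Versioning N E src tgt ι) {x : N ⊕ E} {i : ι} (h : memEl x (V.M i)) :
    ¬ V.dvR x i :=
  fun ⟨_, _, _, hx⟩ => hx h

theorem memEl_of_cvR {N E ι : Type} {src tgt : E → N}
    (V : Versioning N E src tgt ι) {x : N ⊕ E} {i : ι} (h : V.cvR x i) :
    memEl x (V.M i) := by
  rcases h with ⟨_, _, _, hx⟩ | ⟨rfl, hx⟩ <;> exact hx

theorem memEl_of_mvPresent {N E ι : Type} {src tgt : E → N}
    (V : Versioning N E src tgt ι) {x : N ⊕ E} {i : ι} (h : V.mvPresent x i) :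
    memEl x (V.M i) := by
  obtain ⟨j, hcv, _, hpath⟩ := h
  induction hpath with
  | refl => exact V.memEl_of_cvR hcv
  | @tail a b _ hab ih =>
    by_contra hx
    exact hab.2 ⟨a, hab.1, ih, hx⟩

theorem mvPresent_of_memEl {N E ι : Type} {src tgt : E → N}
    (V : Versioning N E src tgt ι) {x : N ⊕ E} {i : ι} (h : memEl x (V.M i)) :
    V.mvPresent x i := by
  have hroot : Relation.ReflTransGen V.delta V.root i := by
    by_cases hi : i = V.root
    · rw [hi]
    · exact (V.root_pre i hi).to_reflTransGen
  induction hroot with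
  | refl => exact ⟨V.root, Or.inr ⟨rfl, h⟩, V.not_dvR_of_memEl h, .refl⟩
  | @tail a b _ hab ih =>
    by_cases ha : memEl x (V.M a)
    · obtain ⟨j, hcv, hdv, hpath⟩ := ih ha
      exact ⟨j, hcv, hdv, hpath.tail ⟨hab, V.not_dvR_of_memEl h⟩⟩
    · exact ⟨b, Or.inl ⟨a, hab, ha, h⟩, V.not_dvR_of_memEl h, .refl⟩

theorem mvPresent_iff_memEl {N E ι : Type} {src tgt : E → N}
    (V : Versioning N E src tgt ι) {x : N ⊕ E} {i : ι} :
    V.mvPresent x i ↔ memEl x (V.M i) :=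
  ⟨V.memEl_of_mvPresent, V.mvPresent_of_memEl⟩

theorem projPG_eq {N E ι : Type} {src tgt : E → N}
    (V : Versioning N E src tgt ι) (i : ι) : V.projPG i = V.M i := by
  simp [projPG, mvPresent_iff_memEl, memEl]

end Versioning

/-- For all versions `i`, `j`:
`proj^Δ (comb Δ) i j = m_{i,j}`, the (unique) maximally preserving model
modification from `M_i` to `M_j` (with partial-identity morphisms and the
intersection as the preserved middle graph). -/
theorem projModif_eq_max_preserving
    {N E ι : Type} (src tgt : E → N) (V : Versioning N E src tgt ι) :
    ∀ i j : ι,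
      (Modif.mk (V.M i)
        ⟨(V.M i).verts ∩ (V.M j).verts, (V.M i).edges ∩ (V.M j).edges⟩
        (V.M j)).MaxPreserving ∧
      V.projModif i j =
        Modif.mk (V.M i)
          ⟨(V.M i).verts ∩ (V.M j).verts, (V.M i).edges ∩ (V.M j).edges⟩
          (V.M j) := by
  intro i j
  refine ⟨⟨rfl, rfl⟩, ?_⟩
  simp only [Versioning.projModif, Versioning.projPG_eq]
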